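/- arXiv:2010.01638 — 5 statements merged into one kernel-verified Lean document; each statement's English description precedes it below -/
import Mathlib

section
/- Let G be a group and A ⊆ G a finite subset generating G. Let c : G → ℝ be a nonnegative function which is a complexity function in the following sense: there exist a finite type 𝒜, a language L ⊆ List 𝒜 closed under concatenation, a surjective map π from {w : List 𝒜 // w ∈ L} onto G satisfying π(w₁ ++ w₂) = π(w₁) * π(w₂), and constants C₁, C₂ > 0 such that for every g ≠ 1 one has (a) c(g) < C₁ * (length of w) for every w ∈ L with π(w) = g, and (b) there exists w ∈ L with π(w) = g and (length of w) < C₂ * c(g). Then c is dominated by the word-length function with respect to A: there exists a constant C > 0 such that for every g ≠ 1 and every list l of elements of G whose entries all lie in A ∪ A⁻¹ and whose product equals g, one has c(g) < C * (length of l). -/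
/-- Concatenating chosen words for the entries of a nonempty list gives a word evaluating to the
product, of length at most `N` times the length of the list. -/
theorem exists_word_prod_eq {G : Type*} [Group G] {𝒜 : Type*} {L : Set (List 𝒜)}
    (π : {w : List 𝒜 // w ∈ L} → G)
    (hmul : ∀ w₁ w₂ : {w : List 𝒜 // w ∈ L}, ∃ h12 : (w₁ : List 𝒜) ++ (w₂ : List 𝒜) ∈ L,
      π ⟨(w₁ : List 𝒜) ++ (w₂ : List 𝒜), h12⟩ = π w₁ * π w₂)
    (s : G → {w : List 𝒜 // w ∈ L}) (hs : ∀ g, π (s g) = g) (N : ℕ) (l : List G) (hne : l ≠ [])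
    (hN : ∀ x ∈ l, (s x : List 𝒜).length ≤ N) :
    ∃ w : {w : List 𝒜 // w ∈ L}, π w = l.prod ∧ (w : List 𝒜).length ≤ N * l.length := by
  induction l, hne using List.recNeNil with
  | singleton x => exact ⟨s x, by simp [hs], by simpa using hN⟩
  | cons x l _ ih =>
    obtain ⟨w, hw, hlen⟩ := ih fun y hy => hN y (List.mem_cons_of_mem x hy)
    obtain ⟨h12, hprod⟩ := hmul (s x) w
    refine ⟨⟨_, h12⟩, by rw [hprod, hs, hw, List.prod_cons], ?_⟩
    have hx := hN x List.mem_cons_self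
    simp only [List.length_append, List.length_cons]
    linarith


/-- If `c` is a complexity function on `G` (comparable to the minimal word length
over some language `L` in a finite alphabet with a concatenation-compatible
surjective evaluation onto `G`), then `c` is dominated by the word-length
function with respect to any finite generating set `A`. -/
theorem wordLength_is_maximal_complexity {G : Type*} [Group G] (A : Finset G)
    (hA : Subgroup.closure (A : Set G) = ⊤)
    (c : G → ℝ) (hc : ∀ g : G, 0 ≤ c g)
    (hcomp : ∃ (𝒜 : Type) (_ : Finite 𝒜) (L : Set (List 𝒜))
      (π : {w : List 𝒜 // w ∈ L} → G),
      Function.Surjective π ∧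
      (∀ w₁ w₂ : {w : List 𝒜 // w ∈ L}, ∃ h12 : (w₁ : List 𝒜) ++ (w₂ : List 𝒜) ∈ L,
        π ⟨(w₁ : List 𝒜) ++ (w₂ : List 𝒜), h12⟩ = π w₁ * π w₂) ∧
      ∃ C₁ > (0 : ℝ), ∃ C₂ > (0 : ℝ), ∀ g : G, g ≠ 1 →
        (∀ w : {w : List 𝒜 // w ∈ L}, π w = g →
          c g < C₁ * ((w : List 𝒜).length : ℝ)) ∧
        (∃ w : {w : List 𝒜 // w ∈ L}, π w = g ∧
          ((w : List 𝒜).length : ℝ) < C₂ * c g)) :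
    ∃ C > (0 : ℝ), ∀ g : G, g ≠ 1 → ∀ l : List G,
      (∀ x ∈ l, x ∈ A ∨ x⁻¹ ∈ A) → l.prod = g →
      c g < C * (l.length : ℝ) := by
  obtain ⟨𝒜, -, L, π, hsurj, hmul, C₁, hC₁, _, -, hcmp⟩ := hcomp
  choose s hs using hsurj
  obtain ⟨N, hN⟩ : ∃ N : ℕ, ∀ x : G, x ∈ A ∨ x⁻¹ ∈ A → (s x : List 𝒜).length ≤ N := by
    have hfin : {x : G | x ∈ A ∨ x⁻¹ ∈ A}.Finite :=
      A.finite_toSet.union (A.finite_toSet.preimage inv_injective.injOn)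
    obtain ⟨N, hN⟩ := (hfin.image fun x => (s x : List 𝒜).length).bddAbove
    exact ⟨N, fun x hx => hN ⟨x, hx, rfl⟩⟩
  refine ⟨C₁ * (N + 1), by positivity, fun g hg l hl hprod => ?_⟩
  have hne : l ≠ [] := by
    rintro rfl
    exact hg hprod.symm
  obtain ⟨w, hw, hlen⟩ := exists_word_prod_eq π hmul s hs N l hne fun x hx => hN x (hl x hx)
  have hlen' : ((w : List 𝒜).length : ℝ) ≤ N * l.length := by exact_mod_cast hlen
  calc c g < C₁ * ((w : List 𝒜).length : ℝ) := (hcmp g hg).1 w (hw.trans hprod)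
    _ ≤ C₁ * ((N + 1) * l.length) := by
      gcongr
      linarith [(Nat.cast_nonneg l.length : (0 : ℝ) ≤ l.length)]
    _ = C₁ * (N + 1) * l.length := by ring
end

section
/- Let G be a group, f : G → ℝ a function, and μ ≥ 0, ε > 0 real constants. Assume f(x*y) ≤ f(x) + f(y) + μ for all x, y ∈ G, and f(g) ≥ ε for every g ≠ 1. Then for every nonempty list l of elements of G none of which equals the identity, f(l.prod) ≤ (1 + μ/ε) * (sum over g in l of f(g)). -/
/-- A function on a group that is subadditive up to an additive constant `μ` and
bounded below by `ε > 0` on nontrivial elements satisfies the multiplicative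
subadditivity bound `f(g₁⋯g_k) ≤ (1 + μ/ε) · (f(g₁) + ⋯ + f(g_k))`. -/
theorem subadditive_up_to_constant_bound {G : Type*} [Group G]
    (f : G → ℝ) (μ ε : ℝ) (hμ : 0 ≤ μ) (hε : 0 < ε)
    (hsub : ∀ x y : G, f (x * y) ≤ f x + f y + μ)
    (hlb : ∀ g : G, g ≠ 1 → ε ≤ f g) :
    ∀ l : List G, l ≠ [] → (∀ g ∈ l, g ≠ 1) →
      f l.prod ≤ (1 + μ / ε) * (l.map f).sum := by
  have hbound : ∀ g : G, g ≠ 1 → f g + μ ≤ (1 + μ / ε) * f g := fun g hg => by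
    have h := mul_le_mul_of_nonneg_left (hlb g hg) (div_nonneg hμ hε.le)
    rw [div_mul_cancel₀ μ hε.ne'] at h
    linarith
  intro l hl hne
  induction l with
  | nil => exact absurd rfl hl
  | cons a t ih =>
    have ha := hbound a (hne a List.mem_cons_self)
    rcases eq_or_ne t [] with rfl | ht
    · simp only [List.prod_cons, List.prod_nil, mul_one, List.map_cons, List.map_nil,
        List.sum_cons, List.sum_nil, add_zero]
      linarith
    · have htail := ih ht fun g hg => hne g (List.mem_cons_of_mem a hg)
      rw [List.prod_cons, List.map_cons, List.sum_cons, mul_add]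
      linarith [hsub a t.prod]
end

section
/- Let n ≥ 1 and let S be a finite set of invertible n×n real matrices which is closed under taking inverses and such that every a ∈ S is unipotent, i.e., (a − 1)^n = 0. Then there exists a constant C > 0 such that for every m, every function a : Fin m → S, and every function k : Fin m → ℤ, the ordered product g = ∏_{i} (a i)^(k i) satisfies log(‖g‖ + 1) ≤ C * (1 + ∑_{i} logb 2 (|k i| + 1)), where ‖·‖ is the Frobenius norm. -/
open Finset

/-- The powers of a unipotent element of a normed ring grow at most polynomially. -/
theorem norm_pow_le_of_sub_one_pow_eq_zero {R : Type*} [NormedRing R] {x : R} {n : ℕ}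
    (hx : (x - 1) ^ n = 0) (k : ℕ) :
    ‖x ^ k‖ ≤ ((k : ℝ) + 1) ^ n * ∑ j ∈ range n, ‖(x - 1) ^ j‖ := by
  have hexp : x ^ k = ∑ j ∈ range (k + 1), k.choose j • (x - 1) ^ j := by
    conv_lhs => rw [← sub_add_cancel x 1, (Commute.one_right (x - 1)).add_pow]
    simp [nsmul_eq_mul, Nat.cast_comm]
  have hterm (j : ℕ) (hj : j < n) :
      ‖k.choose j • (x - 1) ^ j‖ ≤ ((k : ℝ) + 1) ^ n * ‖(x - 1) ^ j‖ := by
    refine norm_nsmul_le.trans (mul_le_mul_of_nonneg_right ?_ (norm_nonneg _))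
    calc (k.choose j : ℝ) ≤ (k : ℝ) ^ j := by exact_mod_cast Nat.choose_le_pow k j
      _ ≤ ((k : ℝ) + 1) ^ j := by gcongr; linarith
      _ ≤ ((k : ℝ) + 1) ^ n := by
        gcongr
        linarith [(Nat.cast_nonneg k : (0 : ℝ) ≤ k)]
  have hvanish (j : ℕ) (hj : n ≤ j) : k.choose j • (x - 1) ^ j = 0 := by
    rw [pow_eq_zero_of_le hj hx, smul_zero]
  have htrunc : x ^ k = ∑ j ∈ range n, k.choose j • (x - 1) ^ j := by
    rw [hexp]
    rcases le_total n (k + 1) with h | h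
    · refine (sum_subset (range_mono h) fun j _ hj => hvanish j ?_).symm
      simpa using hj
    · refine sum_subset (range_mono h) fun j _ hj => ?_
      rw [Nat.choose_eq_zero_of_lt (by simpa using hj), zero_smul]
  rw [htrunc, mul_sum]
  exact norm_sum_le_of_le _ fun j hj => hterm j (mem_range.1 hj)

section Frobenius

attribute [local instance] Matrix.frobeniusNormedRing

/-- Integer powers of the elements of a finite inverse-closed set of unipotent matrices satisfy a
uniform polynomial bound. -/
theorem exists_frobenius_norm_zpow_le {n : ℕ} {S : Finset (Matrix (Fin n) (Fin n) ℝ)}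
    (hcl : ∀ a ∈ S, a⁻¹ ∈ S) (huni : ∀ a ∈ S, (a - 1) ^ n = 0) :
    ∃ d : ℕ, ∀ a ∈ S, ∀ k : ℤ, k ≠ 0 → ‖a ^ k‖ ≤ (|(k : ℝ)| + 1) ^ d := by
  obtain ⟨p, hp⟩ := pow_unbounded_of_one_lt
    (∑ a ∈ S, ∑ j ∈ range n, ‖(a - 1) ^ j‖) (one_lt_two (α := ℝ))
  have hnat (a) (ha : a ∈ S) (k : ℕ) (hk : k ≠ 0) : ‖a ^ k‖ ≤ ((k : ℝ) + 1) ^ (n + p) := by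
    have hk' : (2 : ℝ) ≤ k + 1 := by
      have : (1 : ℝ) ≤ k := by exact_mod_cast Nat.one_le_iff_ne_zero.2 hk
      linarith
    refine (norm_pow_le_of_sub_one_pow_eq_zero (huni a ha) k).trans ?_
    rw [pow_add]
    gcongr
    calc ∑ j ∈ range n, ‖(a - 1) ^ j‖ ≤ ∑ a ∈ S, ∑ j ∈ range n, ‖(a - 1) ^ j‖ :=
          single_le_sum (f := fun a => ∑ j ∈ range n, ‖(a - 1) ^ j‖)
            (fun _ _ => sum_nonneg fun _ _ => norm_nonneg _) ha
      _ ≤ 2 ^ p := hp.le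
      _ ≤ ((k : ℝ) + 1) ^ p := by gcongr
  refine ⟨n + p, fun a ha k hk => ?_⟩
  obtain ⟨l, rfl | rfl⟩ := k.eq_nat_or_neg
  · simpa using hnat a ha l (by simpa using hk)
  · rw [Matrix.zpow_neg_natCast, ← Matrix.inv_pow']
    simpa using hnat a⁻¹ (hcl a ha) l (by simpa using hk)

theorem frobenius_norm_prod_zpow_le {n : ℕ} {S : Finset (Matrix (Fin n) (Fin n) ℝ)} {d : ℕ}
    (hd : ∀ a ∈ S, ∀ k : ℤ, k ≠ 0 → ‖a ^ k‖ ≤ (|(k : ℝ)| + 1) ^ d)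
    (m : ℕ) (a : Fin m → {x // x ∈ S}) (k : Fin m → ℤ) :
    ‖(List.ofFn fun i => (a i : Matrix (Fin n) (Fin n) ℝ) ^ k i).prod‖ ≤
      ‖(1 : Matrix (Fin n) (Fin n) ℝ)‖ * ∏ i, (|(k i : ℝ)| + 1) ^ d := by
  induction m with
  | zero => simp
  | succ m ih =>
    rw [List.ofFn_succ, List.prod_cons, Fin.prod_univ_succ]
    have ih' := ih (fun i => a i.succ) (fun i => k i.succ)
    by_cases h0 : k 0 = 0
    · simpa [h0] using ih'
    · calc _ ≤ _ := norm_mul_le _ _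
        _ ≤ _ := mul_le_mul (hd _ (a 0).2 _ h0) ih' (norm_nonneg _) (by positivity)
        _ = _ := by ring

theorem frobenius_norm_eq_sqrt {n : ℕ} (A : Matrix (Fin n) (Fin n) ℝ) :
    ‖A‖ = Real.sqrt (∑ i, ∑ j, A i j ^ 2) := by
  rw [Matrix.frobenius_norm_def, Real.sqrt_eq_rpow]
  simp

theorem exists_log_frobenius_norm_prod_zpow_le {n : ℕ}
    {S : Finset (Matrix (Fin n) (Fin n) ℝ)}
    (hcl : ∀ a ∈ S, a⁻¹ ∈ S) (huni : ∀ a ∈ S, (a - 1) ^ n = 0) :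
    ∃ C > (0 : ℝ), ∀ (m : ℕ) (a : Fin m → {x // x ∈ S}) (k : Fin m → ℤ),
      Real.log (‖(List.ofFn fun i => (a i : Matrix (Fin n) (Fin n) ℝ) ^ k i).prod‖ + 1) ≤
        C * (1 + ∑ i, Real.logb 2 (|(k i : ℝ)| + 1)) := by
  obtain ⟨d, hd⟩ := exists_frobenius_norm_zpow_le hcl huni
  set N := ‖(1 : Matrix (Fin n) (Fin n) ℝ)‖ with hN
  have hN0 : 0 ≤ N := norm_nonneg _
  have hlogN : 0 ≤ Real.log (N + 1) := Real.log_nonneg (by linarith)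
  have hlog2 : 0 < Real.log 2 := Real.log_pos one_lt_two
  refine ⟨Real.log (N + 1) + d * Real.log 2 + 1, by positivity, fun m a k => ?_⟩
  set L := ∑ i, Real.logb 2 (|(k i : ℝ)| + 1) with hL
  have hL0 : 0 ≤ L := sum_nonneg fun i _ =>
    Real.logb_nonneg one_lt_two (by linarith [abs_nonneg (k i : ℝ)])
  have hprod := frobenius_norm_prod_zpow_le hd m a k
  set P := ∏ i, (|(k i : ℝ)| + 1) ^ d with hP
  have hP1 : 1 ≤ P := Finset.one_le_prod fun i _ =>
    one_le_pow₀ (by linarith [abs_nonneg (k i : ℝ)])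
  have hlogP : Real.log P = d * Real.log 2 * L := by
    rw [hP, Real.log_prod (fun i _ => by positivity), hL, mul_sum]
    refine sum_congr rfl fun i _ => ?_
    rw [Real.log_pow, Real.logb]
    field_simp
  calc _ ≤ Real.log ((N + 1) * P) :=
        Real.log_le_log (by positivity) (by linarith)
    _ = Real.log (N + 1) + d * Real.log 2 * L := by
        rw [Real.log_mul (by positivity) (by positivity), hlogP]
    _ ≤ _ := by
        have h1 : 0 ≤ Real.log (N + 1) * L := by positivity
        have h2 : 0 ≤ (d : ℝ) * Real.log 2 := by positivity
        linarith

end Frobenius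

/-- For a finite set `S` of invertible unipotent `n×n` real matrices closed under
inverses, the log-norm (Frobenius) of any ordered product of integer powers of
elements of `S` is bounded by a constant times the zipped length
`1 + ∑ log₂(|kᵢ|+1)` of the decomposition. -/
theorem logNorm_le_zipped_length (n : ℕ) (hn : 1 ≤ n)
    (S : Finset (Matrix (Fin n) (Fin n) ℝ))
    (hinv : ∀ a ∈ S, IsUnit a)
    (hcl : ∀ a ∈ S, a⁻¹ ∈ S)
    (huni : ∀ a ∈ S, (a - 1) ^ n = 0) :
    ∃ C > (0 : ℝ), ∀ (m : ℕ) (a : Fin m → {x // x ∈ S}) (k : Fin m → ℤ),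
      Real.log
          (Real.sqrt (∑ i, ∑ j,
            (((List.ofFn fun i => ((a i : Matrix (Fin n) (Fin n) ℝ)) ^ (k i)).prod) i j) ^ 2)
            + 1)
        ≤ C * (1 + ∑ i, Real.logb 2 ((|k i| : ℝ) + 1)) := by
  simpa only [frobenius_norm_eq_sqrt] using exists_log_frobenius_norm_prod_zpow_le hcl huni
end

section
/- Let a, b, c, d, e be natural numbers with a ≥ 1, d ≥ 1, d + e ≤ b, and a + b ≤ c. Then 2*(c + 1)*(a + e + 1)*(c + d + 1) < (a + b + c + 1)*(a + c + 1)*(a + c + d + 1). -/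
/-- Case G of the train track simplification: the gain exceeds 1. -/
theorem caseG_gain (a b c d e : ℕ) (ha : 1 ≤ a) (hd : 1 ≤ d)
    (hde : d + e ≤ b) (h : a + b ≤ c) :
    2 * (c + 1) * (a + e + 1) * (c + d + 1) <
      (a + b + c + 1) * (a + c + 1) * (a + c + d + 1) := by
  have hwide : 2 * (a + e + 1) < a + b + c + 1 := by omega
  calc 2 * (c + 1) * (a + e + 1) * (c + d + 1)
      = 2 * (a + e + 1) * (c + 1) * (c + d + 1) := by ring
    _ < (a + b + c + 1) * (c + 1) * (c + d + 1) := by gcongr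
    _ ≤ (a + b + c + 1) * (a + c + 1) * (a + c + d + 1) := by
      gcongr <;> omega
end

section
/- Let a, c be natural numbers with a ≥ 1 and 2*a ≤ c. Set k = c / a + 1 (integer division, so k ≥ 3) and d = c − (k − 1)*a (equivalently d = c mod a, so 0 ≤ d < a). Then (k + 1)*(d + 1)*(a + d + 1) < (k*a + d + 1)*((k + 1)*a + d + 1). -/
/-- Case K of the train track simplification: the gain of a `k`-times multiple
splitting exceeds its cost `log₂(k+1)`. -/
theorem caseK_gain (a c k d : ℕ) (ha : 1 ≤ a) (hc : 2 * a ≤ c)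
    (hk : k = c / a + 1) (hd : d = c - (k - 1) * a) :
    (k + 1) * (d + 1) * (a + d + 1) < (k * a + d + 1) * ((k + 1) * a + d + 1) := by
  have hda : d + 1 ≤ a := by
    have hmod : d = c % a := by
      rw [hd, hk, Nat.add_sub_cancel, Nat.mod_eq_sub_div_mul]
    exact hmod ▸ Nat.mod_lt c ha
  have hk_pos : 0 < k := hk ▸ Nat.succ_pos _
  have hfst : (k + 1) * (d + 1) ≤ k * a + d + 1 := by
    linarith [Nat.mul_le_mul_left k hda]
  have hsnd : a + d + 1 < (k + 1) * a + d + 1 := by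
    linarith [Nat.mul_pos hk_pos ha]
  exact Nat.mul_lt_mul_of_le_of_lt hfst hsnd (by positivity)
end
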